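/- arXiv:1007.0549 — 2 statements merged into one kernel-verified Lean document; each statement's English description precedes it below -/
import Mathlib

section
/- Let M be a nonempty compact subset of ℝ^D with empty interior and reach at least κ, let 0 < σ < κ, and let S = M ⊕ σ. Let ε > 0 satisfy 5ε < σ. Suppose Ŝ ⊆ ℝ^D is a nonempty compact set with S ⊆ Ŝ, H(S, Ŝ) ≤ ε, and H(∂S, ∂Ŝ) ≤ ε, where ∂ denotes topological frontier. Define σ̂ = sup over y ∈ Ŝ of infDist(y, ∂Ŝ) and M̂ = {y ∈ Ŝ : infDist(y, ∂Ŝ) ≥ σ̂ − 2ε}. Then H(M, M̂) ≤ 4ε. -/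
open Metric MeasureTheory

/-- The closed `σ`-neighborhood `M ⊕ σ = {y : infDist(y, M) ≤ σ}` of a set `M`. -/
def tubeNbhd {E : Type*} [PseudoMetricSpace E] (M : Set E) (σ : ℝ) : Set E :=
  {y | Metric.infDist y M ≤ σ}

theorem aux_ascent {E : Type*} [NormedAddCommGroup E] [InnerProductSpace ℝ E]
    (M : Set E) (hM : M.Nonempty) (hMc : IsCompact M) (x : E)
    (hx0 : 0 < Metric.infDist x M)
    (hx : ∃! y, y ∈ M ∧ dist x y = Metric.infDist x M)
    (c : ℝ) (hc0 : 0 < c) (hc : c < 1) (η : ℝ) (hη : 0 < η) :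
    ∃ x', x' ≠ x ∧ dist x' x < η ∧
      Metric.infDist x M + c * dist x' x ≤ Metric.infDist x' M := by
  obtain ⟨p, ⟨hpM, hpd⟩, huniq⟩ := hx
  have hxp : 0 < ‖x - p‖ := by rw [← dist_eq_norm, hpd]; exact hx0
  have gap : ∃ δ > 0, ∀ q ∈ M, dist x q < Metric.infDist x M + δ →
      c * ‖x - p‖ * ‖x - q‖ < inner ℝ (x - p) (x - q) := by
    set K := M ∩ {q | inner ℝ (x - p) (x - q) ≤ c * ‖x - p‖ * ‖x - q‖} with hK
    have hKc : IsCompact K := by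
      apply hMc.inter_right
      apply isClosed_le <;> fun_prop
    rcases K.eq_empty_or_nonempty with h | h
    · refine ⟨1, one_pos, fun q hq _ => ?_⟩
      by_contra hcon
      have : q ∈ K := ⟨hq, not_lt.1 hcon⟩
      rw [h] at this
      exact this
    · obtain ⟨q0, hq0, hq0d⟩ := hKc.exists_infDist_eq_dist h x
      refine ⟨dist x q0 - Metric.infDist x M, ?_, fun q hq hlt => ?_⟩
      · have h1 : Metric.infDist x M ≤ dist x q0 := Metric.infDist_le_dist_of_mem hq0.1
        rcases h1.lt_or_eq with h2 | h2
        · linarith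
        · exfalso
          have := huniq q0 ⟨hq0.1, h2.symm⟩
          subst this
          have h3 : inner ℝ (x - q0) (x - q0) ≤ c * ‖x - q0‖ * ‖x - q0‖ := hq0.2
          rw [real_inner_self_eq_norm_mul_norm] at h3
          nlinarith [mul_pos hxp hxp]
      · by_contra hcon
        have : q ∈ K := ⟨hq, not_lt.1 hcon⟩
        have := Metric.infDist_le_dist_of_mem (x := x) this
        linarith
  obtain ⟨δ, hδ, hgap⟩ := gap
  set r := min (η / 2) (δ / 4) with hr
  have hr0 : 0 < r := by positivity
  set t := r / ‖x - p‖ with ht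
  have ht0 : 0 < t := by positivity
  have htr : t * ‖x - p‖ = r := by rw [ht]; field_simp
  have hd : dist (x + t • (x - p)) x = r := by
    rw [dist_eq_norm, add_sub_cancel_left, norm_smul, Real.norm_of_nonneg ht0.le, htr]
  have hr1 : r ≤ η / 2 := min_le_left _ _
  have hr2 : r ≤ δ / 4 := min_le_right _ _
  refine ⟨x + t • (x - p), ?_, ?_, ?_⟩
  · intro h
    rw [h, dist_self] at hd
    linarith
  · linarith
  · obtain ⟨q, hq, hqd⟩ := hMc.exists_infDist_eq_dist hM (x + t • (x - p))
    have h1 : Metric.infDist (x + t • (x - p)) M ≤ Metric.infDist x M + r := by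
      rw [← hd]; exact Metric.infDist_le_infDist_add_dist
    have h2 : dist x q ≤ r + dist (x + t • (x - p)) q := by
      rw [← hd, dist_comm _ x]; exact dist_triangle _ _ _
    have h3 := hgap q hq (by linarith)
    have h4 : Metric.infDist x M ≤ dist x q := Metric.infDist_le_dist_of_mem hq
    rw [hqd, hd]
    have h5 : inner ℝ (x + t • (x - p) - q) (x - q) = ‖x - q‖ * ‖x - q‖ +
        t * inner ℝ (x - p) (x - q) := by
      rw [← real_inner_self_eq_norm_mul_norm, ← real_inner_smul_left, ← inner_add_left]
      congr 1; abel
    have h6 := real_inner_le_norm (x + t • (x - p) - q) (x - q)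
    rw [h5] at h6
    rw [dist_eq_norm] at h4 ⊢
    have h7 : 0 < ‖x - q‖ := by linarith
    have h8 : t * (c * ‖x - p‖ * ‖x - q‖) ≤ t * inner ℝ (x - p) (x - q) := by gcongr
    have h9 : t * (c * ‖x - p‖ * ‖x - q‖) = c * r * ‖x - q‖ := by rw [← htr]; ring
    have h10 : (‖x - q‖ + c * r) * ‖x - q‖ ≤ ‖x + t • (x - p) - q‖ * ‖x - q‖ := by nlinarith
    have := le_of_mul_le_mul_right h10 h7
    linarith

theorem aux_frontier {E : Type*} [NormedAddCommGroup E] [InnerProductSpace ℝ E]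
    [ProperSpace E]
    (M : Set E) (hM : M.Nonempty) (hMc : IsCompact M) (κ σ : ℝ) (hσ : 0 < σ) (hσκ : σ < κ)
    (hreach : ∀ x : E, Metric.infDist x M < κ →
      ∃! y, y ∈ M ∧ dist x y = Metric.infDist x M)
    (y : E) (hy0 : 0 < Metric.infDist y M) (hy : Metric.infDist y M ≤ σ) :
    Metric.infDist y (frontier (tubeNbhd M σ)) ≤ σ - Metric.infDist y M := by
  have hcont : Continuous fun x => Metric.infDist x M := Metric.continuous_infDist_pt M
  have hfr : ∀ x, Metric.infDist x M = σ → x ∈ frontier (tubeNbhd M σ) := by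
    intro x hx
    rw [frontier_eq_closure_inter_closure]
    refine ⟨subset_closure hx.le, Metric.mem_closure_iff.2 fun η hη => ?_⟩
    obtain ⟨x', h1, h2, h3⟩ := aux_ascent M hM hMc x (hx ▸ hσ) (hreach x (by linarith))
      (1/2) (by norm_num) (by norm_num) η hη
    refine ⟨x', ?_, by rwa [dist_comm]⟩
    have := dist_pos.2 h1
    intro h
    have h' : Metric.infDist x' M ≤ σ := h
    linarith
  have key : ∀ c : ℝ, 0 < c → c < 1 →
      c * Metric.infDist y (frontier (tubeNbhd M σ)) ≤ σ - Metric.infDist y M := by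
    intro c hc0 hc
    set K := {x | Metric.infDist y M + c * dist x y ≤ Metric.infDist x M} ∩
      {x | Metric.infDist x M ≤ σ} with hK
    have hKcl : IsClosed K := by
      apply IsClosed.inter
      · apply isClosed_le <;> fun_prop
      · exact isClosed_le hcont continuous_const
    have hKc : IsCompact K := by
      refine (isCompact_closedBall y (σ / c)).of_isClosed_subset hKcl fun x hx => ?_
      rw [Metric.mem_closedBall, le_div_iff₀ hc0]
      have h1 : Metric.infDist y M + c * dist x y ≤ Metric.infDist x M := hx.1
      have h2 : Metric.infDist x M ≤ σ := hx.2
      linarith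
    have hKn : K.Nonempty := ⟨y, by simp [hK, hy]⟩
    obtain ⟨x, hxK, hmax⟩ := hKc.exists_isMaxOn hKn hcont.continuousOn
    have h1 : Metric.infDist y M + c * dist x y ≤ Metric.infDist x M := hxK.1
    have h2 : Metric.infDist x M ≤ σ := hxK.2
    have hd0 : 0 ≤ c * dist x y := by positivity
    have h3 : Metric.infDist x M = σ := by
      by_contra hne
      have hlt := lt_of_le_of_ne h2 hne
      obtain ⟨x', g1, g2, g3⟩ := aux_ascent M hM hMc x (by linarith) (hreach x (by linarith))
        c hc0 hc (σ - Metric.infDist x M) (by linarith)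
      have g4 : Metric.infDist x' M ≤ Metric.infDist x M + dist x' x :=
        Metric.infDist_le_infDist_add_dist
      have g5 : c * dist x' y ≤ c * (dist x' x + dist x y) := by
        gcongr; exact dist_triangle _ _ _
      have g6 : x' ∈ K := ⟨by rw [Set.mem_setOf_eq]; linarith, by rw [Set.mem_setOf_eq]; linarith⟩
      have g7 : Metric.infDist x' M ≤ Metric.infDist x M := hmax g6
      have g8 := mul_pos hc0 (dist_pos.2 g1)
      linarith
    have h4 : Metric.infDist y (frontier (tubeNbhd M σ)) ≤ dist y x :=
      Metric.infDist_le_dist_of_mem (hfr x h3)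
    rw [dist_comm] at h4
    have := mul_le_mul_of_nonneg_left h4 hc0.le
    linarith
  have hn : 0 ≤ Metric.infDist y (frontier (tubeNbhd M σ)) := Metric.infDist_nonneg
  refine le_of_forall_pos_le_add fun e he => ?_
  set d := Metric.infDist y (frontier (tubeNbhd M σ))
  have h1 : 0 < d + e + 1 := by linarith
  have := key ((d + 1) / (d + e + 1)) (by positivity) (by rw [div_lt_one h1]; linarith)
  have h2 : d - (d + 1) / (d + e + 1) * d ≤ e := by
    have : d - (d + 1) / (d + e + 1) * d = e * (d / (d + e + 1)) := by field_simp; ring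
    rw [this]
    have : d / (d + e + 1) ≤ 1 := by rw [div_le_one h1]; linarith
    nlinarith
  linarith

/-- **Deterministic accuracy of the peeled estimator (core of Lemma 16).**
Let `M ⊆ ℝ^D` be nonempty, compact, with empty interior and reach at least `κ`, let
`0 < σ < κ` and `S = M ⊕ σ`.  Let `ε > 0` with `5ε < σ`, and let `Ŝ` be a nonempty compact
set with `S ⊆ Ŝ`, `H(S, Ŝ) ≤ ε` and `H(∂S, ∂Ŝ) ≤ ε`.  With
`σ̂ = sup_{y ∈ Ŝ} infDist(y, ∂Ŝ)` and `M̂ = {y ∈ Ŝ : infDist(y, ∂Ŝ) ≥ σ̂ - 2ε}`, we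
have `H(M, M̂) ≤ 4ε`. -/
theorem peeled_estimator_accuracy (D : ℕ) (M : Set (EuclideanSpace ℝ (Fin D)))
    (hM : M.Nonempty) (hMc : IsCompact M) (hMi : interior M = ∅)
    (κ σ : ℝ) (hκ : 0 < κ) (hσ : 0 < σ) (hσκ : σ < κ)
    (hreach : ∀ x : EuclideanSpace ℝ (Fin D), Metric.infDist x M < κ →
      ∃! y, y ∈ M ∧ dist x y = Metric.infDist x M)
    (ε : ℝ) (hε : 0 < ε) (hε5 : 5 * ε < σ)
    (Shat : Set (EuclideanSpace ℝ (Fin D))) (hShat : Shat.Nonempty)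
    (hShatc : IsCompact Shat) (hsub : tubeNbhd M σ ⊆ Shat)
    (hH : Metric.hausdorffDist (tubeNbhd M σ) Shat ≤ ε)
    (hHb : Metric.hausdorffDist (frontier (tubeNbhd M σ)) (frontier Shat) ≤ ε) :
    Metric.hausdorffDist M
      {y ∈ Shat |
        sSup ((fun z => Metric.infDist z (frontier Shat)) '' Shat) - 2 * ε ≤
          Metric.infDist y (frontier Shat)} ≤ 4 * ε := by
  set S := tubeNbhd M σ with hS
  have hcont : Continuous fun x => Metric.infDist x M := Metric.continuous_infDist_pt M
  have hScl : IsClosed S := isClosed_le hcont continuous_const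
  have hSc : IsCompact S := hShatc.of_isClosed_subset hScl hsub
  have hMS : M ⊆ S := fun x hx => by
    show Metric.infDist x M ≤ σ
    rw [Metric.infDist_zero_of_mem hx]; exact hσ.le
  have hSn : S.Nonempty := hM.mono hMS
  have hnt : Nontrivial (EuclideanSpace ℝ (Fin D)) := by
    by_contra h
    rw [not_nontrivial_iff_subsingleton] at h
    have : M = Set.univ := Subsingleton.eq_univ_of_nonempty hM
    rw [this, interior_univ] at hMi
    exact (Set.univ_nonempty).ne_empty hMi
  have hnc : NoncompactSpace (EuclideanSpace ℝ (Fin D)) := NormedSpace.noncompactSpace ℝ _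
  have hfrS : (frontier S).Nonempty := nonempty_frontier_iff.2 ⟨hSn, hSc.ne_univ⟩
  have hfrH : (frontier Shat).Nonempty := nonempty_frontier_iff.2 ⟨hShat, hShatc.ne_univ⟩
  have hbS : Bornology.IsBounded (frontier S) := hSc.isBounded.subset hScl.frontier_subset
  have hbH : Bornology.IsBounded (frontier Shat) :=
    hShatc.isBounded.subset hShatc.isClosed.frontier_subset
  have hfin := Metric.hausdorffEDist_ne_top_of_nonempty_of_bounded hfrS hfrH hbS hbH
  have hfin' := Metric.hausdorffEDist_ne_top_of_nonempty_of_bounded hfrH hfrS hbH hbS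
  have hfinS := Metric.hausdorffEDist_ne_top_of_nonempty_of_bounded hSn hShat hSc.isBounded
    hShatc.isBounded
  have c1 : ∀ x, Metric.infDist x (frontier Shat) ≤ Metric.infDist x (frontier S) + ε := by
    intro x
    have := Metric.infDist_le_infDist_add_hausdorffDist (x := x) hfin
    linarith
  have c2 : ∀ x, Metric.infDist x (frontier S) ≤ Metric.infDist x (frontier Shat) + ε := by
    intro x
    have := Metric.infDist_le_infDist_add_hausdorffDist (x := x) hfin'
    rw [Metric.hausdorffDist_comm] at this
    linarith
  -- points of M are far from the frontier
  have a1 : ∀ x ∈ M, σ ≤ Metric.infDist x (frontier S) := by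
    intro x hx
    refine (Metric.le_infDist hfrS).2 fun z hz => ?_
    have hz1 : Metric.infDist z M = σ := frontier_le_subset_eq hcont continuous_const hz
    rw [← hz1, dist_comm]
    exact Metric.infDist_le_dist_of_mem hx
  have a2 : ∀ y ∈ S, 0 < Metric.infDist y M →
      Metric.infDist y (frontier S) ≤ σ - Metric.infDist y M := fun y hy hy0 =>
    aux_frontier M hM hMc κ σ hσ hσκ hreach y hy0 hy
  have a3 : ∀ y ∈ S, Metric.infDist y (frontier S) ≤ σ := by
    intro y hy
    rcases (Metric.infDist_nonneg (x := y) (s := M)).lt_or_eq with h | h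
    · linarith [a2 y hy h]
    · have hyM : y ∈ M := (hMc.isClosed.mem_iff_infDist_zero hM).2 h.symm
      refine le_of_forall_pos_le_add fun e he => ?_
      have hdense : Dense Mᶜ := interior_eq_empty_iff_dense_compl.1 hMi
      obtain ⟨z, hz, hzd⟩ := hdense.exists_dist_lt y (lt_min he hσ)
      have hz0 : 0 < Metric.infDist z M := (hMc.isClosed.notMem_iff_infDist_pos hM).1 hz
      have hzS : z ∈ S := by
        show Metric.infDist z M ≤ σ
        have := Metric.infDist_le_dist_of_mem (x := z) hyM
        rw [dist_comm] at this
        linarith [min_le_right e σ]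
      have h1 := a2 z hzS hz0
      have h2 : Metric.infDist y (frontier S) ≤ Metric.infDist z (frontier S) + dist y z :=
        Metric.infDist_le_infDist_add_dist
      linarith [min_le_left e σ]
  have a4 : ∀ y ∈ Shat, y ∉ S → Metric.infDist y (frontier Shat) ≤ 2 * ε := by
    intro y hy hyS
    obtain ⟨z, hz, hzd⟩ := exists_mem_frontier_infDist_compl_eq_dist
      (s := Sᶜ) (x := y) hyS (by simpa [Set.compl_eq_univ_diff] using hSn.ne_empty)
    rw [compl_compl] at hzd
    rw [frontier_compl] at hz
    have h1 : Metric.infDist y S ≤ Metric.hausdorffDist Shat S :=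
      Metric.infDist_le_hausdorffDist_of_mem hy (by rwa [Metric.hausdorffEDist_comm])
    rw [Metric.hausdorffDist_comm] at h1
    have h2 := Metric.infDist_le_dist_of_mem (x := y) hz
    linarith [c1 y]
  have a5 : ∀ y ∈ Shat, Metric.infDist y (frontier Shat) ≤ σ + ε := by
    intro y hy
    by_cases h : y ∈ S
    · linarith [c1 y, a3 y h]
    · linarith [a4 y hy h]
  set s := sSup ((fun z => Metric.infDist z (frontier Shat)) '' Shat) with hs
  have s1 : s ≤ σ + ε := by
    apply csSup_le (hShat.image _)
    rintro _ ⟨y, hy, rfl⟩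
    exact a5 y hy
  have s2 : σ - ε ≤ s := by
    obtain ⟨m, hm⟩ := hM
    have h1 : Metric.infDist m (frontier Shat) ≤ s := by
      refine le_csSup ⟨σ + ε, ?_⟩ ⟨m, hsub (hMS hm), rfl⟩
      rintro _ ⟨y, hy, rfl⟩
      exact a5 y hy
    linarith [c2 m, a1 m hm]
  apply Metric.hausdorffDist_le_of_infDist (by positivity)
  · intro x hx
    rw [Metric.infDist_zero_of_mem]
    · positivity
    · exact ⟨hsub (hMS hx), by linarith [c2 x, a1 x hx]⟩
  · rintro y ⟨hy, hyd⟩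
    have hyS : y ∈ S := by
      by_contra h
      linarith [a4 y hy h]
    rcases (Metric.infDist_nonneg (x := y) (s := M)).lt_or_eq with h | h
    · linarith [a2 y hyS h, c1 y]
    · rw [← h]; positivity
end

section
/- Let 𝒦 ⊆ ℝ^D be a nonempty compact set, let κ > 0 and 0 < σ < κ. Then there exists a constant C > 0, depending only on D, σ, κ, and 𝒦, such that for all nonempty compact sets M₁, M₂ ⊆ 𝒦, each with reach at least κ, letting uᵢ = 𝟙_{Mᵢ ⊕ σ} / V(Mᵢ ⊕ σ) be the density of the uniform distribution on the tube Mᵢ ⊕ σ, one has min(κ − σ, H(M₁, M₂)) ≤ C · (∫_{ℝ^D} |u₁(y) − u₂(y)| dy)^{1/D}. -/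
open Metric MeasureTheory

/-- The density `𝟙_S / V(S)` of the uniform distribution on a set `S ⊆ ℝ^D`. -/
noncomputable def unifDensity {E : Type*} [MeasureSpace E] (S : Set E) (y : E) : ℝ :=
  Set.indicator S (fun _ => 1) y / (volume S).toReal

theorem slope_aux {E : Type*} [NormedAddCommGroup E] [InnerProductSpace ℝ E]
    (M : Set E) (hM : M.Nonempty) (hMc : IsCompact M) (w : E) (hw : 0 < infDist w M)
    (hu : ∃! y, y ∈ M ∧ dist w y = infDist w M) (δ : ℝ) (hδ : 0 < δ) (hδ1 : δ < 1)
    (η : ℝ) (hη : 0 < η) :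
    ∃ h > 0, h ≤ η ∧ ∃ w', dist w' w ≤ h ∧ infDist w M + (1 - δ) * h < infDist w' M := by
  obtain ⟨p, ⟨hpM, hp⟩, huniq⟩ := hu
  set d := infDist w M with hd
  have hnp : ‖w - p‖ = d := by rw [← dist_eq_norm, hp]
  set v : E := (1 / d) • (w - p) with hv
  have hvn : ‖v‖ = 1 := by
    rw [hv, norm_smul, hnp, Real.norm_of_nonneg (by positivity)]; field_simp
  have hvp : inner ℝ v (w - p) = d := by
    rw [hv, real_inner_smul_left, real_inner_self_eq_norm_sq, hnp]; field_simp
  set A : Set E := M ∩ {q | inner ℝ v (w - q) ≤ (1 - δ) * d} with hA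
  have hAc : IsCompact A := by
    apply hMc.inter_right
    exact isClosed_le (by fun_prop) (by fun_prop)
  have hμ : ∃ μ > 0, ∀ q ∈ A, d + μ ≤ dist w q := by
    rcases A.eq_empty_or_nonempty with h | h
    · exact ⟨1, one_pos, by simp [h]⟩
    · obtain ⟨q, hq, hmin⟩ := hAc.exists_isMinOn h
        (f := fun q => dist w q) (by fun_prop)
      refine ⟨dist w q - d, ?_, fun q' hq' => ?_⟩
      · have h1 : d ≤ dist w q := infDist_le_dist_of_mem hq.1
        rcases h1.lt_or_eq with h2 | h2
        · linarith
        · exfalso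
          have := huniq q ⟨hq.1, h2.symm⟩
          have h3 : inner ℝ v (w - q) ≤ (1 - δ) * d := hq.2
          rw [this, hvp] at h3
          nlinarith
      · have : dist w q ≤ dist w q' := hmin hq'
        linarith
  obtain ⟨μ, hμ0, hμ⟩ := hμ
  have hh0 : 0 < min η (μ / 3) := by positivity
  have hh1 : min η (μ / 3) ≤ μ / 3 := min_le_right _ _
  refine ⟨min η (μ / 3), hh0, min_le_left _ _, ?_⟩
  generalize min η (μ / 3) = h at hh0 hh1
  have hdist : dist (w + h • v) w = h := by
    rw [dist_eq_norm, add_sub_cancel_left, norm_smul, hvn, Real.norm_of_nonneg hh0.le, mul_one]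
  refine ⟨w + h • v, hdist.le, ?_⟩
  obtain ⟨q, hqM, hq⟩ := hMc.exists_infDist_eq_dist hM (w + h • v)
  have h1 : infDist (w + h • v) M ≤ d + dist (w + h • v) w := infDist_le_infDist_add_dist
  have h2 : dist w q ≤ dist w (w + h • v) + dist (w + h • v) q := dist_triangle _ _ _
  rw [dist_comm w (w + h • v), hdist, ← hq] at h2
  have hqA : (1 - δ) * d < inner ℝ v (w - q) := by
    by_contra hc
    have := hμ q ⟨hqM, not_lt.1 hc⟩
    linarith
  have h3 : d ≤ ‖w - q‖ := by rw [← dist_eq_norm]; exact infDist_le_dist_of_mem hqM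
  have h4 : dist (w + h • v) q ^ 2 = ‖w - q‖ ^ 2 + 2 * (h * inner ℝ v (w - q)) + h ^ 2 := by
    rw [dist_eq_norm, show w + h • v - q = (w - q) + h • v by abel, norm_add_sq_real,
      real_inner_smul_right, norm_smul, hvn, real_inner_comm, Real.norm_of_nonneg hh0.le, mul_one]
  rw [hq]
  apply lt_of_pow_lt_pow_left₀ 2 dist_nonneg
  rw [h4]
  have h5 : d ^ 2 ≤ ‖w - q‖ ^ 2 := by gcongr
  have h6 : h * ((1 - δ) * d) < h * inner ℝ v (w - q) := by gcongr
  have h7 : ((1 - δ) * h) ^ 2 ≤ h ^ 2 := by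
    have : (1 - δ) * h ≤ h := by nlinarith
    have : 0 ≤ (1 - δ) * h := mul_nonneg (by linarith) hh0.le
    gcongr
  nlinarith

theorem push_aux {E : Type*} [NormedAddCommGroup E] [InnerProductSpace ℝ E] [ProperSpace E]
    (M : Set E) (hM : M.Nonempty) (hMc : IsCompact M) (κ : ℝ)
    (hr : ∀ x : E, infDist x M < κ → ∃! y, y ∈ M ∧ dist x y = infDist x M)
    (x : E) (hx : 0 < infDist x M) (ε : ℝ) (hε : 0 ≤ ε) (hxε : infDist x M + ε < κ) :
    ∃ z, dist z x ≤ ε ∧ infDist x M + ε ≤ infDist z M := by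
  have hc : IsCompact (closedBall x ε) := isCompact_closedBall x ε
  have hne : (closedBall x ε).Nonempty := ⟨x, mem_closedBall_self hε⟩
  have hcont : Continuous fun z : E => infDist z M := continuous_infDist_pt M
  obtain ⟨z, hz, hmax⟩ := hc.exists_isMaxOn hne hcont.continuousOn
  refine ⟨z, hz, ?_⟩
  have key : ∀ δ : ℝ, 0 < δ → δ < 1 → infDist x M + (1 - δ) * ε ≤ infDist z M := by
    intro δ hδ hδ1
    obtain ⟨w, hw, hwmax⟩ := hc.exists_isMaxOn hne
      (f := fun z => infDist z M - (1 - δ) * dist z x) (by fun_prop)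
    have h1 : infDist x M - (1 - δ) * dist x x ≤ infDist w M - (1 - δ) * dist w x :=
      hwmax (mem_closedBall_self hε)
    rw [dist_self, mul_zero, sub_zero] at h1
    have h2 : infDist w M ≤ infDist z M := hmax hw
    have hwε : dist w x ≤ ε := hw
    rcases hwε.lt_or_eq with hlt | heq
    · exfalso
      have h0 : 0 ≤ (1 - δ) * dist w x := mul_nonneg (by linarith) dist_nonneg
      have h3 : infDist w M ≤ infDist x M + dist w x := infDist_le_infDist_add_dist
      obtain ⟨h, hh, hhη, w', hw', hlt'⟩ := slope_aux M hM hMc w (by linarith)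
        (hr w (by linarith)) δ hδ hδ1 (ε - dist w x) (by linarith)
      have h4 : dist w' x ≤ dist w' w + dist w x := dist_triangle _ _ _
      have h5 : infDist w' M - (1 - δ) * dist w' x ≤ infDist w M - (1 - δ) * dist w x :=
        hwmax (show dist w' x ≤ ε by linarith)
      have h6 : (1 - δ) * dist w' x ≤ (1 - δ) * (h + dist w x) :=
        mul_le_mul_of_nonneg_left (by linarith) (by linarith)
      nlinarith
    · rw [heq] at h1; linarith
  by_contra hcon
  push Not at hcon
  rcases hε.eq_or_lt with h0 | h0
  · have := key (1/2) (by norm_num) (by norm_num)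
    rw [← h0] at this hcon
    linarith
  · set g := infDist x M + ε - infDist z M with hg
    have hg0 : 0 < g := by linarith
    have h1 := key (min (1/2) (g / (2 * ε))) (by positivity)
      (lt_of_le_of_lt (min_le_left _ _) (by norm_num))
    have h2 : min (1/2) (g / (2 * ε)) * ε ≤ g / (2 * ε) * ε := by
      gcongr; exact min_le_right _ _
    have h3 : g / (2 * ε) * ε = g / 2 := by field_simp
    nlinarith

theorem tube_closed {E : Type*} [PseudoMetricSpace E] (M : Set E) (σ : ℝ) :
    IsClosed (tubeNbhd M σ) :=
  isClosed_le (continuous_infDist_pt M) continuous_const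

theorem tube_compact {E : Type*} [PseudoMetricSpace E] [ProperSpace E] (M : Set E) (σ : ℝ)
    (hM : M.Nonempty) (hMc : IsCompact M) : IsCompact (tubeNbhd M σ) := by
  refine (hMc.cthickening (r := σ)).of_isClosed_subset (tube_closed M σ) fun y hy => ?_
  obtain ⟨q, hqM, hq⟩ := hMc.exists_infDist_eq_dist hM y
  exact mem_cthickening_of_dist_le y q σ M hqM (hq ▸ hy)

theorem dens_integrable {D : ℕ} (M : Set (EuclideanSpace ℝ (Fin D))) (σ : ℝ)
    (hM : M.Nonempty) (hMc : IsCompact M) :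
    Integrable (unifDensity (tubeNbhd M σ)) := by
  have : Integrable (Set.indicator (tubeNbhd M σ)
      (fun _ : EuclideanSpace ℝ (Fin D) => (1 : ℝ))) :=
    (integrable_indicator_iff (tube_closed M σ).measurableSet).2
      (integrableOn_const (tube_compact M σ hM hMc).measure_lt_top.ne)
  exact this.div_const _

theorem l1_lower {D : ℕ} (K M₁ M₂ : Set (EuclideanSpace ℝ (Fin D))) (σ ρ : ℝ)
    (hK : K.Nonempty) (hKc : IsCompact K)
    (h1 : M₁.Nonempty) (h2 : M₂.Nonempty) (hc1 : IsCompact M₁) (hc2 : IsCompact M₂)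
    (h1K : M₁ ⊆ K) (hρ : 0 < ρ) (z : EuclideanSpace ℝ (Fin D))
    (hz1 : ball z ρ ⊆ tubeNbhd M₁ σ) (hz2 : ball z ρ ⊆ (tubeNbhd M₂ σ)ᶜ) :
    ρ ^ D * (volume (ball (0 : EuclideanSpace ℝ (Fin D)) 1)).toReal /
      (volume (tubeNbhd K σ)).toReal ≤
      ∫ y, |unifDensity (tubeNbhd M₁ σ) y - unifDensity (tubeNbhd M₂ σ) y| := by
  have hint : Integrable fun y =>
      |unifDensity (tubeNbhd M₁ σ) y - unifDensity (tubeNbhd M₂ σ) y| :=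
    ((dens_integrable M₁ σ h1 hc1).sub (dens_integrable M₂ σ h2 hc2)).abs
  have hvB : (volume (ball z ρ)).toReal =
      ρ ^ D * (volume (ball (0 : EuclideanSpace ℝ (Fin D)) 1)).toReal := by
    rw [Measure.addHaar_ball_of_pos volume z hρ, finrank_euclideanSpace_fin, ENNReal.toReal_mul,
      ENNReal.toReal_ofReal (by positivity)]
  have hBpos : 0 < (volume (ball z ρ)).toReal :=
    ENNReal.toReal_pos (measure_ball_pos volume z hρ).ne' measure_ball_lt_top.ne
  have hB1 : (volume (ball z ρ)).toReal ≤ (volume (tubeNbhd M₁ σ)).toReal :=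
    ENNReal.toReal_mono (tube_compact M₁ σ h1 hc1).measure_lt_top.ne (measure_mono hz1)
  have h1V : (volume (tubeNbhd M₁ σ)).toReal ≤ (volume (tubeNbhd K σ)).toReal :=
    ENNReal.toReal_mono (tube_compact K σ hK hKc).measure_lt_top.ne
      (measure_mono fun y hy => (infDist_le_infDist_of_subset h1K h1).trans hy)
  calc _ ≤ (volume (ball z ρ)).toReal / (volume (tubeNbhd M₁ σ)).toReal := by
        rw [← hvB]
        exact div_le_div_of_nonneg_left hBpos.le (by linarith) h1V
    _ = ∫ y in ball z ρ, (1 / (volume (tubeNbhd M₁ σ)).toReal) := by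
        rw [setIntegral_const, smul_eq_mul, Measure.real]; ring
    _ = ∫ y in ball z ρ, |unifDensity (tubeNbhd M₁ σ) y - unifDensity (tubeNbhd M₂ σ) y| := by
        refine setIntegral_congr_fun measurableSet_ball fun y hy => ?_
        have e1 : y ∈ tubeNbhd M₁ σ := hz1 hy
        have e2 : y ∉ tubeNbhd M₂ σ := hz2 hy
        simp only [unifDensity, Set.indicator_of_mem e1, Set.indicator_of_notMem e2]
        rw [zero_div, sub_zero, abs_of_nonneg (by positivity)]
    _ ≤ _ := setIntegral_le_integral hint (Filter.Eventually.of_forall fun y => abs_nonneg _)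

theorem one_side {D : ℕ} (hD : D ≠ 0) (K M₁ M₂ : Set (EuclideanSpace ℝ (Fin D))) (κ σ : ℝ)
    (hσ : 0 < σ) (hσκ : σ < κ)
    (hK : K.Nonempty) (hKc : IsCompact K)
    (h1 : M₁.Nonempty) (h2 : M₂.Nonempty) (hc1 : IsCompact M₁) (hc2 : IsCompact M₂)
    (h1K : M₁ ⊆ K)
    (hr : ∀ x : EuclideanSpace ℝ (Fin D), Metric.infDist x M₂ < κ →
        ∃! y, y ∈ M₂ ∧ dist x y = Metric.infDist x M₂)
    (x : EuclideanSpace ℝ (Fin D)) (hx : x ∈ M₁) :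
    min (κ - σ) (infDist x M₂) ≤ ((2 + (κ - σ) / σ) *
      ((volume (tubeNbhd K σ)).toReal /
        (volume (ball (0 : EuclideanSpace ℝ (Fin D)) 1)).toReal) ^ ((1 : ℝ) / D)) *
      (∫ y, |unifDensity (tubeNbhd M₁ σ) y - unifDensity (tubeNbhd M₂ σ) y|) ^
          ((1 : ℝ) / D) := by
  have hL : 0 ≤ ∫ y, |unifDensity (tubeNbhd M₁ σ) y - unifDensity (tubeNbhd M₂ σ) y| :=
    integral_nonneg fun y => abs_nonneg _
  have hκσ : 0 < κ - σ := by linarith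
  rcases (infDist_nonneg (x := x) (s := M₂)).eq_or_lt with h0 | h0
  · rw [← h0, min_eq_right hκσ.le]; positivity
  set t := min (κ - σ) (infDist x M₂) with ht
  have ht0 : 0 < t := lt_min hκσ h0
  have ht1 : t ≤ κ - σ := min_le_left _ _
  have ht2 : t ≤ infDist x M₂ := min_le_right _ _
  obtain ⟨ρ, hρ0, hρt, hρσ, htρ⟩ : ∃ ρ > 0, ρ ≤ t / 2 ∧ ρ ≤ σ ∧ t ≤ (2 + (κ - σ) / σ) * ρ := by
    refine ⟨min (t / 2) σ, by positivity, min_le_left _ _, min_le_right _ _, ?_⟩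
    have hq : 0 < (κ - σ) / σ := by positivity
    rcases min_cases (t / 2) σ with ⟨h, _⟩ | ⟨h, _⟩
    · rw [h]; nlinarith
    · rw [h, add_mul, div_mul_cancel₀ _ hσ.ne']; linarith
  obtain ⟨z, hzx, hz⟩ : ∃ z, dist z x ≤ σ - ρ ∧ σ + ρ ≤ infDist z M₂ := by
    rcases le_or_gt (σ + ρ) (infDist x M₂) with h | h
    · exact ⟨x, by rw [dist_self]; linarith, h⟩
    · obtain ⟨z, hz1, hz2⟩ := push_aux M₂ h2 hc2 κ hr x h0 (σ + ρ - infDist x M₂)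
        (by linarith) (by linarith)
      exact ⟨z, by linarith, by linarith⟩
  have hlow := l1_lower K M₁ M₂ σ ρ hK hKc h1 h2 hc1 hc2 h1K hρ0 z
    (fun y hy => by
      have hy' : dist y z < ρ := hy
      have a : infDist y M₁ ≤ dist y x := infDist_le_dist_of_mem hx
      have b := dist_triangle y z x
      show infDist y M₁ ≤ σ
      linarith)
    (fun y hy => by
      have hy' : dist y z < ρ := hy
      have a : infDist z M₂ ≤ infDist y M₂ + dist z y := infDist_le_infDist_add_dist
      rw [dist_comm] at a
      show ¬ (infDist y M₂ ≤ σ)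
      push Not
      linarith)
  generalize (∫ y, |unifDensity (tubeNbhd M₁ σ) y - unifDensity (tubeNbhd M₂ σ) y|) = L at *
  have hω : 0 < (volume (ball (0 : EuclideanSpace ℝ (Fin D)) 1)).toReal :=
    ENNReal.toReal_pos (measure_ball_pos volume _ one_pos).ne' measure_ball_lt_top.ne
  have hV : 0 < (volume (tubeNbhd K σ)).toReal := by
    obtain ⟨k, hk⟩ := hK
    refine ENNReal.toReal_pos ?_ (tube_compact K σ ⟨k, hk⟩ hKc).measure_lt_top.ne
    refine ((measure_ball_pos volume k hσ).trans_le (measure_mono fun y hy => ?_)).ne'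
    exact (infDist_le_dist_of_mem hk).trans (le_of_lt hy)
  generalize (volume (ball (0 : EuclideanSpace ℝ (Fin D)) 1)).toReal = ω at *
  generalize (volume (tubeNbhd K σ)).toReal = V at *
  have hpow : ρ ^ D ≤ V / ω * L := by
    rw [div_le_iff₀ hV] at hlow
    rw [div_mul_eq_mul_div, le_div_iff₀ hω]
    linarith
  have hroot : ρ ≤ (V / ω) ^ ((1 : ℝ) / D) * L ^ ((1 : ℝ) / D) := by
    rw [← Real.mul_rpow (by positivity) hL]
    calc ρ = (ρ ^ D) ^ ((1 : ℝ) / D) := by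
          rw [one_div, Real.pow_rpow_inv_natCast hρ0.le hD]
      _ ≤ _ := by gcongr
  rw [mul_assoc]
  refine htρ.trans ?_
  gcongr

/-- **Calibration: Hausdorff distance vs. L¹ distance of the tube densities (Lemma 9).**
For a nonempty compact `𝒦 ⊆ ℝ^D`, `κ > 0` and `0 < σ < κ` there is a constant `C > 0`
(depending only on `D, σ, κ, 𝒦`) such that for all nonempty compact `M₁, M₂ ⊆ 𝒦` with
reach at least `κ`, letting `uᵢ` be the uniform density on the tube `Mᵢ ⊕ σ`,
`min(κ - σ, H(M₁, M₂)) ≤ C (∫ |u₁ - u₂|)^{1/D}`. -/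
theorem hausdorff_le_l1_calibration (D : ℕ) (K : Set (EuclideanSpace ℝ (Fin D)))
    (hK : K.Nonempty) (hKc : IsCompact K)
    (κ σ : ℝ) (hκ : 0 < κ) (hσ : 0 < σ) (hσκ : σ < κ) :
    ∃ C > (0 : ℝ), ∀ M₁ M₂ : Set (EuclideanSpace ℝ (Fin D)),
      M₁.Nonempty → M₂.Nonempty → IsCompact M₁ → IsCompact M₂ →
      M₁ ⊆ K → M₂ ⊆ K →
      (∀ x : EuclideanSpace ℝ (Fin D), Metric.infDist x M₁ < κ →
        ∃! y, y ∈ M₁ ∧ dist x y = Metric.infDist x M₁) →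
      (∀ x : EuclideanSpace ℝ (Fin D), Metric.infDist x M₂ < κ →
        ∃! y, y ∈ M₂ ∧ dist x y = Metric.infDist x M₂) →
      min (κ - σ) (Metric.hausdorffDist M₁ M₂) ≤
        C * (∫ y, |unifDensity (tubeNbhd M₁ σ) y - unifDensity (tubeNbhd M₂ σ) y|) ^
          ((1 : ℝ) / D) := by
  rcases eq_or_ne D 0 with rfl | hD
  · refine ⟨1, one_pos, fun M₁ M₂ h1 h2 _ _ _ _ _ _ => ?_⟩
    have : M₁ = M₂ := by
      rw [Set.Nonempty.eq_univ h1, Set.Nonempty.eq_univ h2]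
    rw [this, hausdorffDist_self_zero]
    refine (min_le_right _ _).trans ?_
    have : 0 ≤ ∫ y, |unifDensity (tubeNbhd M₂ σ) y - unifDensity (tubeNbhd M₂ σ) y| :=
      integral_nonneg fun y => abs_nonneg _
    positivity
  have hκσ : 0 < κ - σ := by linarith
  have hω : 0 < (volume (ball (0 : EuclideanSpace ℝ (Fin D)) 1)).toReal :=
    ENNReal.toReal_pos (measure_ball_pos volume _ one_pos).ne' measure_ball_lt_top.ne
  have hV : 0 < (volume (tubeNbhd K σ)).toReal := by
    obtain ⟨k, hk⟩ := hK
    refine ENNReal.toReal_pos ?_ (tube_compact K σ ⟨k, hk⟩ hKc).measure_lt_top.ne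
    refine ((measure_ball_pos volume k hσ).trans_le (measure_mono fun y hy => ?_)).ne'
    exact (infDist_le_dist_of_mem hk).trans (le_of_lt hy)
  refine ⟨(2 + (κ - σ) / σ) *
      ((volume (tubeNbhd K σ)).toReal /
        (volume (ball (0 : EuclideanSpace ℝ (Fin D)) 1)).toReal) ^ ((1 : ℝ) / D),
      by positivity, fun M₁ M₂ h1 h2 hc1 hc2 h1K h2K hr1 hr2 => ?_⟩
  have hL : 0 ≤ ∫ y, |unifDensity (tubeNbhd M₁ σ) y - unifDensity (tubeNbhd M₂ σ) y| :=
    integral_nonneg fun y => abs_nonneg _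
  have s1 := one_side hD K M₁ M₂ κ σ hσ hσκ hK hKc h1 h2 hc1 hc2 h1K hr2
  have s2 := one_side hD K M₂ M₁ κ σ hσ hσκ hK hKc h2 h1 hc2 hc1 h2K hr1
  simp only [abs_sub_comm (unifDensity (tubeNbhd M₂ σ) _)] at s2
  set R := ((2 + (κ - σ) / σ) *
      ((volume (tubeNbhd K σ)).toReal /
        (volume (ball (0 : EuclideanSpace ℝ (Fin D)) 1)).toReal) ^ ((1 : ℝ) / D)) *
      (∫ y, |unifDensity (tubeNbhd M₁ σ) y - unifDensity (tubeNbhd M₂ σ) y|) ^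
          ((1 : ℝ) / D) with hR
  have hR0 : 0 ≤ R := by positivity
  rcases le_or_gt (κ - σ) R with h | h
  · exact (min_le_left _ _).trans h
  · refine (min_le_right _ _).trans (hausdorffDist_le_of_infDist hR0 ?_ ?_)
    · intro x hx
      exact (min_le_iff.1 (s1 x hx)).resolve_left (not_le.2 h)
    · intro x hx
      exact (min_le_iff.1 (s2 x hx)).resolve_left (not_le.2 h)
end
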